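/- arXiv:1312.2528 — 2 statements merged into one kernel-verified Lean document; each statement's English description precedes it below -/
import Mathlib

section
/- Critical temperature of the mean-field bound for Dyson's hierarchical model: let 1/2 < σ ≤ 1, J = 1, h = 0, and φ_MF(m) = log 2 + log cosh(β C_σ m) − (β/2)(C_σ m² + D_σ) for m ∈ [−1,1], where C_σ = Σ_{l=1}^{∞} 2^{l(1−2σ)} = 1/(2^{2σ−1} − 1) and D_σ = Σ_{l=1}^{∞} 2^{−2lσ} = 1/(2^{2σ} − 1). Then m = 0 maximizes φ_MF over [−1,1] if and only if β ≤ β_c^{MF} := 2^{2σ−1} − 1. -/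
theorem one_add_sq_div_two_le_cosh (x : ℝ) : 1 + x ^ 2 / 2 ≤ Real.cosh x := by
  wlog hx : 0 ≤ x generalizing x
  · simpa using this (-x) (by linarith)
  have hsinh : x / 2 ≤ Real.sinh (x / 2) := Real.self_le_sinh_iff.mpr (by linarith)
  have hcosh : Real.cosh x = 1 + 2 * Real.sinh (x / 2) ^ 2 := by
    have h := Real.cosh_two_mul (x / 2)
    rw [mul_div_cancel₀ x two_ne_zero, Real.cosh_sq] at h
    linarith
  nlinarith

theorem log_cosh_le_half_sq (x : ℝ) : Real.log (Real.cosh x) ≤ x ^ 2 / 2 :=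
  (Real.log_le_iff_le_exp (Real.cosh_pos x)).mpr (Real.cosh_le_exp_half_sq x)

theorem sq_div_two_add_sq_le_log_cosh (x : ℝ) :
    x ^ 2 / (2 + x ^ 2) ≤ Real.log (Real.cosh x) := by
  have hpos : 0 < 1 + x ^ 2 / 2 := by positivity
  calc x ^ 2 / (2 + x ^ 2) = 1 - (1 + x ^ 2 / 2)⁻¹ := by field_simp; ring
    _ ≤ Real.log (1 + x ^ 2 / 2) := Real.one_sub_inv_le_log_of_pos hpos
    _ ≤ Real.log (Real.cosh x) := Real.log_le_log hpos (one_add_sq_div_two_le_cosh x)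

theorem forall_log_cosh_mul_le_iff {a : ℝ} (ha : 0 ≤ a) :
    (∀ m ∈ Set.Icc (-1 : ℝ) 1, Real.log (Real.cosh (a * m)) ≤ a / 2 * m ^ 2) ↔ a ≤ 1 := by
  constructor
  · intro h
    by_contra! ha1
    have hsq : √(a - 1) ^ 2 = a - 1 := Real.sq_sqrt (by linarith)
    have hle : √(a - 1) ≤ a := Real.sqrt_le_iff.mpr ⟨ha, by nlinarith⟩
    have hm : √(a - 1) / a ∈ Set.Icc (-1 : ℝ) 1 :=
      ⟨by linarith [div_nonneg (Real.sqrt_nonneg (a - 1)) ha], div_le_one_of_le₀ hle ha⟩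
    have hlow := (sq_div_two_add_sq_le_log_cosh (a * (√(a - 1) / a))).trans (h _ hm)
    rw [mul_div_cancel₀ _ (by linarith : a ≠ 0), div_pow, hsq] at hlow
    have hrhs : a / 2 * ((a - 1) / a ^ 2) = (a - 1) / (2 * a) := by field_simp
    rw [hrhs, div_le_div_iff₀ (by linarith) (by linarith)] at hlow
    nlinarith
  · intro ha1 m _
    have hlog := log_cosh_le_half_sq (a * m)
    nlinarith [mul_nonneg (mul_nonneg ha (sub_nonneg.mpr ha1)) (sq_nonneg m)]


/-- Critical temperature of the mean-field bound for Dyson's hierarchical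
model: for `1/2 < σ ≤ 1`, `J = 1`, `h = 0`, with
`φ_MF(m) = log 2 + log cosh(β C_σ m) − (β/2)(C_σ m² + D_σ)`,
`C_σ = ∑_{l=1}^∞ 2^{l(1−2σ)} = 1/(2^{2σ−1} − 1)` and
`D_σ = ∑_{l=1}^∞ 2^{−2lσ} = 1/(2^{2σ} − 1)`,
the point `m = 0` maximizes `φ_MF` over `[−1,1]` if and only if `β ≤ β_c^MF = 2^{2σ−1} − 1`. -/
theorem dyson_mean_field_critical_temperature (σ β : ℝ) (hσ1 : 1 / 2 < σ) (hσ2 : σ ≤ 1)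
    (hβ : 0 ≤ β) (C D : ℝ)
    (hCsum : C = ∑' l : ℕ, (2 : ℝ) ^ (((l : ℝ) + 1) * (1 - 2 * σ)))
    (hC : C = 1 / ((2 : ℝ) ^ (2 * σ - 1) - 1))
    (hDsum : D = ∑' l : ℕ, (2 : ℝ) ^ (-2 * ((l : ℝ) + 1) * σ))
    (hD : D = 1 / ((2 : ℝ) ^ (2 * σ) - 1))
    (φMF : ℝ → ℝ)
    (hφ : ∀ m : ℝ, φMF m = Real.log 2 + Real.log (Real.cosh (β * C * m))
        - β / 2 * (C * m ^ 2 + D)) :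
    (∀ m ∈ Set.Icc (-1 : ℝ) 1, φMF m ≤ φMF 0) ↔ β ≤ (2 : ℝ) ^ (2 * σ - 1) - 1 := by
  have hK : 0 < (2 : ℝ) ^ (2 * σ - 1) - 1 :=
    sub_pos.mpr (Real.one_lt_rpow one_lt_two (by linarith))
  have hCpos : 0 < C := hC ▸ one_div_pos.mpr hK
  have hβC : β * C ≤ 1 ↔ β ≤ (2 : ℝ) ^ (2 * σ - 1) - 1 := by
    rw [hC, mul_one_div, div_le_one hK]
  rw [← hβC, ← forall_log_cosh_mul_le_iff (mul_nonneg hβ hCpos.le)]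
  refine forall₂_congr fun m _ => ?_
  rw [hφ, hφ, mul_zero, Real.cosh_zero, Real.log_one]
  constructor <;> intro h <;> linarith
end

section
/- Critical temperature of the non-mean-field bound for Dyson's hierarchical model: let 1/2 < σ ≤ 1, J = 1, h = 0, and φ_NMF(m) = log 2 + log cosh(β (C_σ − D_σ) m) − (β/2)(C_σ − D_σ) m² for m ∈ [−1,1], where C_σ = Σ_{l=1}^{∞} 2^{l(1−2σ)} = 1/(2^{2σ−1} − 1) and D_σ = Σ_{l=1}^{∞} 2^{−2lσ} = 1/(2^{2σ} − 1). Then m = 0 maximizes φ_NMF over [−1,1] if and only if β ≤ β_c^{NMF} := 2^{1−2σ} − 3 + 2^{2σ}. -/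
/-- The quadratic Taylor lower bound for `cosh`. -/
theorem one_add_sq_half_le_cosh {y : ℝ} (hy : 0 ≤ y) : 1 + y ^ 2 / 2 ≤ Real.cosh y := by
  have h1 : y / 2 ≤ Real.sinh (y / 2) := Real.self_le_sinh_iff.2 (by linarith)
  have h2 := Real.cosh_two_mul (y / 2)
  have h3 := Real.cosh_sq (y / 2)
  rw [mul_div_cancel₀ y two_ne_zero] at h2
  nlinarith

/-- The Curie-Weiss dichotomy: `log cosh (t m) ≤ t m² / 2` throughout `[-1, 1]` iff `t ≤ 1`. -/
theorem forall_log_cosh_le_iff {t : ℝ} (ht : 0 ≤ t) :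
    (∀ m ∈ Set.Icc (-1 : ℝ) 1, Real.log (Real.cosh (t * m)) ≤ t / 2 * m ^ 2) ↔ t ≤ 1 := by
  constructor
  · intro h
    by_contra! ht1
    set y := Real.sqrt (t - 1)
    have hy : y ^ 2 = t - 1 := Real.sq_sqrt (by linarith)
    have hy0 : 0 ≤ y := Real.sqrt_nonneg _
    have ht0 : 0 < t := by linarith
    have hm : y / t ≤ 1 := by
      rw [div_le_one ht0]
      nlinarith [sq_nonneg (y - 1)]
    have h1 := h (y / t) ⟨by linarith [div_nonneg hy0 ht], hm⟩
    rw [mul_div_cancel₀ y ht0.ne', div_pow, hy] at h1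
    have h2 := Real.le_log_one_add_of_nonneg (x := y ^ 2 / 2) (by positivity)
    have h3 := Real.log_le_log (by positivity) (one_add_sq_half_le_cosh hy0)
    have h4 := (h2.trans h3).trans h1
    rw [hy] at h4
    have h5 : 2 * ((t - 1) / 2) / ((t - 1) / 2 + 2) = 2 * (t - 1) / (t + 3) := by
      field_simp
      ring
    have h6 : t / 2 * ((t - 1) / t ^ 2) = (t - 1) / (2 * t) := by
      field_simp
    rw [h5, h6, div_le_div_iff₀ (by linarith) (by linarith)] at h4
    nlinarith [mul_pos (sub_pos.2 ht1) (sub_pos.2 ht1)]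
  · intro ht1 m _
    have h1 := Real.log_le_log (Real.cosh_pos _) (Real.cosh_le_exp_half_sq (t * m))
    rw [Real.log_exp] at h1
    nlinarith [mul_nonneg (mul_nonneg ht (sub_nonneg.2 ht1)) (sq_nonneg m)]

/-- Critical temperature of the non-mean-field bound for Dyson's
hierarchical model: for `1/2 < σ ≤ 1`, `J = 1`, `h = 0`, with
`φ_NMF(m) = log 2 + log cosh(β (C_σ − D_σ) m) − (β/2)(C_σ − D_σ) m²`,
`C_σ = ∑_{l=1}^∞ 2^{l(1−2σ)} = 1/(2^{2σ−1} − 1)` and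
`D_σ = ∑_{l=1}^∞ 2^{−2lσ} = 1/(2^{2σ} − 1)`,
the point `m = 0` maximizes `φ_NMF` over `[−1,1]` if and only if
`β ≤ β_c^NMF = 2^{1−2σ} − 3 + 2^{2σ}`. -/
theorem dyson_non_mean_field_critical_temperature (σ β : ℝ) (hσ1 : 1 / 2 < σ) (hσ2 : σ ≤ 1)
    (hβ : 0 ≤ β) (C D : ℝ)
    (hCsum : C = ∑' l : ℕ, (2 : ℝ) ^ (((l : ℝ) + 1) * (1 - 2 * σ)))
    (hC : C = 1 / ((2 : ℝ) ^ (2 * σ - 1) - 1))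
    (hDsum : D = ∑' l : ℕ, (2 : ℝ) ^ (-2 * ((l : ℝ) + 1) * σ))
    (hD : D = 1 / ((2 : ℝ) ^ (2 * σ) - 1))
    (φNMF : ℝ → ℝ)
    (hφ : ∀ m : ℝ, φNMF m = Real.log 2 + Real.log (Real.cosh (β * (C - D) * m))
        - β / 2 * (C - D) * m ^ 2) :
    (∀ m ∈ Set.Icc (-1 : ℝ) 1, φNMF m ≤ φNMF 0) ↔
      β ≤ (2 : ℝ) ^ (1 - 2 * σ) - 3 + (2 : ℝ) ^ (2 * σ) := by
  set x := (2 : ℝ) ^ (2 * σ)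
  have hx2 : 2 < x := by
    simpa using Real.rpow_lt_rpow_of_exponent_lt one_lt_two
      (show (1 : ℝ) < 2 * σ by linarith)
  have hx0 : 0 < x := by linarith
  have e1 : (2 : ℝ) ^ (2 * σ - 1) = x / 2 := by
    rw [Real.rpow_sub two_pos, Real.rpow_one]
  have e2 : (2 : ℝ) ^ (1 - 2 * σ) = 2 / x := by
    rw [Real.rpow_sub two_pos, Real.rpow_one]
  have ha : C - D = x / ((x - 2) * (x - 1)) := by
    have h1 : x - 2 ≠ 0 := by linarith
    have h2 : x - 1 ≠ 0 := by linarith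
    have h3 : x / 2 - 1 = (x - 2) / 2 := by ring
    rw [hC, hD, e1, h3]
    field_simp
    ring
  have hp : 0 < (x - 2) * (x - 1) := mul_pos (by linarith) (by linarith)
  have hc : (2 : ℝ) ^ (1 - 2 * σ) - 3 + x = (C - D)⁻¹ := by
    rw [ha, e2, inv_div]
    field_simp
    ring
  have ha0 : 0 < C - D := ha ▸ div_pos hx0 hp
  rw [hc, ← one_div, le_div_iff₀ ha0, ← forall_log_cosh_le_iff (mul_nonneg hβ ha0.le)]
  refine forall₂_congr fun m _ => ?_
  rw [hφ, hφ, mul_zero, Real.cosh_zero, Real.log_one]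
  constructor <;> intro h <;> linarith
end
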